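/- Let p be an odd prime and let q make G = (ℤ/pℤ) × (ℤ/pℤ) into a nondegenerate metric group. Then ∑_{g∈G} q(g) = p or ∑_{g∈G} q(g) = −p; moreover ∑_{g∈G} q(g) = p if and only if there exists a nonzero element g ∈ G with q(g) = 1, and in that case the cyclic subgroup generated by such a g is a Lagrangian subgroup of order p. -/

import Mathlib

/-- The bimultiplicative form associated to a quadratic form `q` on a group:
`b(g,h) = q(g*h) * q(g)⁻¹ * q(h)⁻¹`. -/
def metricForm {G : Type*} [Group G] (q : G → ℂˣ) (g h : G) : ℂˣ :=
  q (g * h) * (q g)⁻¹ * (q h)⁻¹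

open AddChar

section QuadraticGaussSum

variable {F : Type*} [Field F] [Fintype F] [DecidableEq F]

/-- The quadratic character of a finite field with values in `ℂ`. -/
noncomputable def complexQuadraticChar (F : Type*) [Field F] [Fintype F] [DecidableEq F] :
    MulChar F ℂ :=
  (quadraticChar F).ringHomComp (Int.castRingHom ℂ)

lemma complexQuadraticChar_apply (a : F) :
    complexQuadraticChar F a = (quadraticChar F a : ℂ) := rfl

lemma sum_addChar_mul_sq (hF : ringChar F ≠ 2) {ψ : AddChar F ℂ} (hψ : ψ.IsPrimitive)
    {c : F} (hc : c ≠ 0) :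
    ∑ x, ψ (c * x ^ 2) = complexQuadraticChar F c * gaussSum (complexQuadraticChar F) ψ := by
  have hfib : ∑ x, ψ (c * x ^ 2) = ∑ a, ((quadraticChar F a : ℂ) + 1) * ψ (c * a) := by
    rw [← Finset.sum_fiberwise_of_maps_to (s := Finset.univ) (t := Finset.univ)
      (g := fun x : F ↦ x ^ 2) (fun _ _ ↦ Finset.mem_univ _)]
    refine Finset.sum_congr rfl fun a _ ↦ ?_
    rw [Finset.sum_congr rfl (g := fun _ ↦ ψ (c * a)) (fun x hx ↦ by
      rw [(Finset.mem_filter.mp hx).2]), Finset.sum_const, nsmul_eq_mul]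
    congr 1
    have h := quadraticChar_card_sqrts hF a
    rw [show {x : F | x ^ 2 = a}.toFinset = Finset.univ.filter (fun x ↦ x ^ 2 = a) by
      ext; simp] at h
    exact_mod_cast h
  have hzero : ∑ a, ψ (c * a) = 0 := by
    simpa [hc, mul_comm] using sum_mulShift c hψ
  have hsq : complexQuadraticChar F c * complexQuadraticChar F c = 1 := by
    rw [complexQuadraticChar_apply, ← Int.cast_mul, ← pow_two, quadraticChar_sq_one hc,
      Int.cast_one]
  have hshift := gaussSum_mulShift (complexQuadraticChar F) ψ (Units.mk0 c hc)
  rw [hfib, ← hshift, Units.val_mk0, ← mul_assoc, hsq, one_mul]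
  simp only [add_mul, one_mul, Finset.sum_add_distrib, hzero, add_zero]
  rfl

lemma gaussSum_complexQuadraticChar_sq (hF : ringChar F ≠ 2) {ψ : AddChar F ℂ}
    (hψ : ψ.IsPrimitive) :
    gaussSum (complexQuadraticChar F) ψ ^ 2 = complexQuadraticChar F (-1) * Fintype.card F :=
  gaussSum_sq
    ((MulChar.ringHomComp_ne_one_iff (RingHom.injective_int _)).mpr (quadraticChar_ne_one hF))
    ((quadraticChar_isQuadratic F).comp _) hψ

/-- The Gauss sum of a nondegenerate binary quadratic form is determined by its discriminant. -/
lemma sum_addChar_binary_form (hF : ringChar F ≠ 2) {ψ : AddChar F ℂ} (hψ : ψ.IsPrimitive)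
    {α β γ : F} (hD : γ ^ 2 - 4 * α * β ≠ 0) :
    ∑ x, ∑ y, ψ (α * x ^ 2 + γ * x * y + β * y ^ 2) =
      quadraticChar F (γ ^ 2 - 4 * α * β) * Fintype.card F := by
  have h2 : (2 : F) ≠ 0 := Ring.two_ne_zero hF
  rw [Finset.sum_comm]
  by_cases hα : α = 0
  · subst hα
    have hγ : γ ≠ 0 := by rintro rfl; simp at hD
    have hinner (y : F) : ∑ x, ψ (0 * x ^ 2 + γ * x * y + β * y ^ 2) =
        if y = 0 then (Fintype.card F : ℂ) else 0 := by
      have h := sum_mulShift (γ * y) hψ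
      simp only [map_add_eq_mul, zero_mul, map_zero_eq_one, one_mul, ← Finset.sum_mul]
      rw [Finset.sum_congr rfl (fun x _ ↦ by rw [show γ * x * y = x * (γ * y) by ring]), h]
      by_cases hy : y = 0 <;> simp [hy, hγ]
    rw [Finset.sum_congr rfl (fun y _ ↦ hinner y)]
    simp [quadraticChar_sq_one' hγ, -quadraticChar_apply]
  · set D := γ ^ 2 - 4 * α * β with hDdef
    have h4α : 4 * α ≠ 0 := by
      rw [show (4 : F) = 2 * 2 by norm_num]
      exact mul_ne_zero (mul_ne_zero h2 h2) hα
    have hδ : -D / (4 * α) ≠ 0 := div_ne_zero (neg_ne_zero.mpr hD) h4α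
    have hinner (y : F) : ∑ x, ψ (α * x ^ 2 + γ * x * y + β * y ^ 2) =
        (∑ x, ψ (α * x ^ 2)) * ψ (-D / (4 * α) * y ^ 2) := by
      rw [Finset.sum_mul]
      refine Fintype.sum_equiv (Equiv.addRight (γ * y / (2 * α))) _ _ fun x ↦ ?_
      rw [← map_add_eq_mul, Equiv.coe_addRight]
      congr 1
      have h4 : (4 : F) ≠ 0 := left_ne_zero_of_mul h4α
      rw [hDdef]
      field_simp
      ring
    have hχ : complexQuadraticChar F α * complexQuadraticChar F (-D / (4 * α)) *
        complexQuadraticChar F (-1) = quadraticChar F D := by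
      rw [← complexQuadraticChar_apply, ← map_mul, ← map_mul,
        show α * (-D / (4 * α)) * -1 = D * (2⁻¹) ^ 2 by
          have h4 : (4 : F) ≠ 0 := left_ne_zero_of_mul h4α
          field_simp
          ring, map_mul, complexQuadraticChar_apply (2⁻¹ ^ 2),
        quadraticChar_sq_one' (inv_ne_zero h2), Int.cast_one, mul_one]
    rw [Finset.sum_congr rfl (fun y _ ↦ hinner y), ← Finset.mul_sum,
      sum_addChar_mul_sq hF hψ hα, sum_addChar_mul_sq hF hψ hδ, ← hχ]
    linear_combination complexQuadraticChar F α * complexQuadraticChar F (-D / (4 * α)) *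
      gaussSum_complexQuadraticChar_sq hF hψ

/-- A binary quadratic form is isotropic if and only if its discriminant is a square. -/
lemma isSquare_discrim_iff_exists_isotropic {K : Type*} [Field K] (h2 : (2 : K) ≠ 0) (α β γ : K) :
    IsSquare (γ ^ 2 - 4 * α * β) ↔
      ∃ x y, (x ≠ 0 ∨ y ≠ 0) ∧ α * x ^ 2 + γ * x * y + β * y ^ 2 = 0 := by
  constructor
  · rintro ⟨d, hd⟩
    by_cases hα : α = 0
    · exact ⟨1, 0, by simp, by simp [hα]⟩
    · exact ⟨-γ + d, 2 * α, Or.inr (mul_ne_zero h2 hα), by linear_combination -α * hd⟩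
  · rintro ⟨x, y, hne, h⟩
    by_cases hy : y = 0
    · have hx : x ≠ 0 := by tauto
      have hα : α = 0 := by simpa [hy, hx] using h
      exact ⟨γ, by rw [hα]; ring⟩
    · refine ⟨(2 * α * x + γ * y) / y, ?_⟩
      field_simp
      linear_combination (-4 * α) * h

end QuadraticGaussSum

section MetricForm

variable {G : Type*} [CommGroup G] {q : G → ℂˣ}

lemma metricForm_comm (g h : G) : metricForm q g h = metricForm q h g := by
  simp only [metricForm, mul_comm g h, mul_assoc, mul_comm (q g)⁻¹]

lemma map_mul_eq_metricForm_mul (q : G → ℂˣ) (g h : G) : q (g * h) = metricForm q g h * q g * q h := by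
  simp [metricForm, mul_assoc]

lemma metricForm_one_left
    (hq2 : ∀ g₁ g₂ h, metricForm q (g₁ * g₂) h = metricForm q g₁ h * metricForm q g₂ h) (h : G) :
    metricForm q 1 h = 1 := by
  simpa using hq2 1 1 h

lemma map_one_of_metricForm
    (hq2 : ∀ g₁ g₂ h, metricForm q (g₁ * g₂) h = metricForm q g₁ h * metricForm q g₂ h) :
    q 1 = 1 := by
  simpa [metricForm] using metricForm_one_left hq2 1

lemma metricForm_pow_left
    (hq2 : ∀ g₁ g₂ h, metricForm q (g₁ * g₂) h = metricForm q g₁ h * metricForm q g₂ h)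
    (g h : G) (n : ℕ) : metricForm q (g ^ n) h = metricForm q g h ^ n := by
  induction n with
  | zero => simpa using metricForm_one_left hq2 h
  | succ n ih => rw [pow_succ, hq2, ih, pow_succ]

lemma metricForm_pow_pow
    (hq2 : ∀ g₁ g₂ h, metricForm q (g₁ * g₂) h = metricForm q g₁ h * metricForm q g₂ h)
    (g h : G) (m n : ℕ) : metricForm q (g ^ m) (h ^ n) = metricForm q g h ^ (m * n) := by
  rw [metricForm_pow_left hq2, metricForm_comm, metricForm_pow_left hq2, metricForm_comm,
    ← pow_mul, mul_comm]

lemma metricForm_self (hq1 : ∀ g, q g⁻¹ = q g)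
    (hq2 : ∀ g₁ g₂ h, metricForm q (g₁ * g₂) h = metricForm q g₁ h * metricForm q g₂ h) (g : G) :
    metricForm q g g = q g ^ 2 := by
  have h := hq2 g⁻¹ g g
  rw [inv_mul_cancel, metricForm_one_left hq2] at h
  have h' : metricForm q g⁻¹ g = (q g ^ 2)⁻¹ := by
    simp [metricForm, hq1, map_one_of_metricForm hq2, pow_two]
  rw [h'] at h
  exact (inv_mul_eq_one.mp h.symm).symm

lemma map_pow_of_metricForm (hq1 : ∀ g, q g⁻¹ = q g)
    (hq2 : ∀ g₁ g₂ h, metricForm q (g₁ * g₂) h = metricForm q g₁ h * metricForm q g₂ h)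
    (g : G) (n : ℕ) : q (g ^ n) = q g ^ (n ^ 2) := by
  induction n with
  | zero => simpa using map_one_of_metricForm hq2
  | succ n ih =>
    rw [pow_succ, map_mul_eq_metricForm_mul q, metricForm_pow_left hq2, metricForm_self hq1 hq2, ih,
      ← pow_mul, ← pow_add, ← pow_succ]
    ring_nf

lemma map_pow_eq_one_of_odd (hq1 : ∀ g, q g⁻¹ = q g)
    (hq2 : ∀ g₁ g₂ h, metricForm q (g₁ * g₂) h = metricForm q g₁ h * metricForm q g₂ h)
    {n : ℕ} (hn : Odd n) {g : G} (hg : g ^ n = 1) : q g ^ n = 1 := by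
  have h₁ : q g ^ (n * n) = 1 := by
    rw [← pow_two, ← map_pow_of_metricForm hq1 hq2, hg, map_one_of_metricForm hq2]
  have h₂ : q g ^ (n * 2) = 1 := by
    rw [mul_comm, pow_mul, ← metricForm_self hq1 hq2, ← metricForm_pow_left hq2, hg,
      metricForm_one_left hq2]
  have h := pow_gcd_eq_one.mpr ⟨h₁, h₂⟩
  rwa [Nat.gcd_mul_left, hn.coprime_two_right.gcd_eq_one, mul_one] at h

end MetricForm

lemma ZMod.exists_stdAddChar_eq {n : ℕ} [NeZero n] {z : ℂˣ} (hz : z ^ n = 1) :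
    ∃ a : ZMod n, stdAddChar a = z := by
  have hprim : IsPrimitiveRoot (stdAddChar (1 : ZMod n)) n := by
    have h := Complex.isPrimitiveRoot_exp n (NeZero.ne n)
    have h1 := ZMod.stdAddChar_coe (N := n) 1
    rw [Int.cast_one, Int.cast_one, mul_one] at h1
    rwa [h1]
  obtain ⟨i, -, hi⟩ := hprim.eq_pow_of_pow_eq_one (Units.ext_iff.mp hz)
  exact ⟨i, by rw [← hi, ← AddChar.map_nsmul_eq_pow, nsmul_one]⟩

/-- A quadratic function on `(ℤ/nℤ)²`, `n` odd, is the exponential of a binary quadratic form. -/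
lemma exists_binary_form_of_metricForm {n : ℕ} [NeZero n] (hn : Odd n)
    {q : Multiplicative (ZMod n × ZMod n) → ℂˣ} (hq1 : ∀ g, q g⁻¹ = q g)
    (hq2 : ∀ g₁ g₂ h, metricForm q (g₁ * g₂) h = metricForm q g₁ h * metricForm q g₂ h) :
    ∃ α β γ : ZMod n, ∀ x y : ZMod n, (q (Multiplicative.ofAdd (x, y)) : ℂ) =
      ZMod.stdAddChar (α * x ^ 2 + γ * x * y + β * y ^ 2) := by
  set e₁ : Multiplicative (ZMod n × ZMod n) := Multiplicative.ofAdd (1, 0) with he₁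
  set e₂ : Multiplicative (ZMod n × ZMod n) := Multiplicative.ofAdd (0, 1) with he₂
  have hpow₁ : e₁ ^ n = 1 := by
    rw [he₁, ← ofAdd_nsmul]; simp
  have hpow₂ : e₂ ^ n = 1 := by
    rw [he₂, ← ofAdd_nsmul]; simp
  obtain ⟨α, hα⟩ := ZMod.exists_stdAddChar_eq (n := n) (z := q e₁)
    (map_pow_eq_one_of_odd hq1 hq2 hn hpow₁)
  obtain ⟨β, hβ⟩ := ZMod.exists_stdAddChar_eq (n := n) (z := q e₂)
    (map_pow_eq_one_of_odd hq1 hq2 hn hpow₂)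
  obtain ⟨γ, hγ⟩ := ZMod.exists_stdAddChar_eq (n := n) (z := metricForm q e₁ e₂) (by
    rw [← metricForm_pow_left hq2, hpow₁, metricForm_one_left hq2])
  refine ⟨α, β, γ, fun x y ↦ ?_⟩
  obtain ⟨i, rfl⟩ := ZMod.natCast_zmod_surjective x
  obtain ⟨j, rfl⟩ := ZMod.natCast_zmod_surjective y
  have hdecomp : Multiplicative.ofAdd ((i : ZMod n), (j : ZMod n)) = e₁ ^ i * e₂ ^ j := by
    rw [he₁, he₂, ← ofAdd_nsmul, ← ofAdd_nsmul, ← ofAdd_add]; simp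
  rw [hdecomp, map_mul_eq_metricForm_mul q, metricForm_pow_pow hq2,
    map_pow_of_metricForm hq1 hq2, map_pow_of_metricForm hq1 hq2]
  push_cast
  rw [← hα, ← hβ, ← hγ]
  simp only [← AddChar.map_nsmul_eq_pow, ← AddChar.map_add_eq_mul, nsmul_eq_mul]
  congr 1
  push_cast
  ring

/-- Let `p` be an odd prime and `q` a nondegenerate metric group
structure on `G = (ℤ/pℤ) × (ℤ/pℤ)`. Then the Gauss sum `∑ q(g)` equals `p` or `-p`;
it equals `p` iff there is a nonzero `g` with `q(g) = 1`, and in that case the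
cyclic subgroup generated by any such `g` is a Lagrangian subgroup of order `p`. -/
theorem rank_two_elementary_abelian_gauss_sum
    (p : ℕ) (hp : p.Prime) (hodd : Odd p) [NeZero p]
    (q : Multiplicative (ZMod p × ZMod p) → ℂˣ)
    (hq1 : ∀ g, q g⁻¹ = q g)
    (hq2 : ∀ g₁ g₂ h, metricForm q (g₁ * g₂) h = metricForm q g₁ h * metricForm q g₂ h)
    (hnd : ∀ g, (∀ h, metricForm q g h = 1) → g = 1) :
    ((∑ g : Multiplicative (ZMod p × ZMod p), (q g : ℂ)) = p ∨
     (∑ g : Multiplicative (ZMod p × ZMod p), (q g : ℂ)) = -p) ∧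
    ((∑ g : Multiplicative (ZMod p × ZMod p), (q g : ℂ)) = p ↔
      ∃ g : Multiplicative (ZMod p × ZMod p), g ≠ 1 ∧ q g = 1) ∧
    (∀ g : Multiplicative (ZMod p × ZMod p), g ≠ 1 → q g = 1 →
      (∀ h ∈ Subgroup.zpowers g, q h = 1) ∧
      ((Subgroup.zpowers g : Set (Multiplicative (ZMod p × ZMod p)))
        = {x | ∀ h ∈ Subgroup.zpowers g, metricForm q x h = 1}) ∧
      Nat.card ↥(Subgroup.zpowers g) = p) := by
  have : Fact p.Prime := ⟨hp⟩
  have hp2 : p ≠ 2 := by rintro rfl; exact absurd hodd (by decide)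
  have hF : ringChar (ZMod p) ≠ 2 := by rwa [ZMod.ringChar_zmod_n]
  have h2 : (2 : ZMod p) ≠ 0 := Ring.two_ne_zero hF
  obtain ⟨α, β, γ, hQ⟩ := exists_binary_form_of_metricForm hodd hq1 hq2
  have hψ (a : ZMod p) : ZMod.stdAddChar a = 1 ↔ a = 0 := by
    rw [← (ZMod.stdAddChar (N := p)).map_zero_eq_one, ZMod.injective_stdAddChar.eq_iff]
  have hq_one (x y : ZMod p) : q (Multiplicative.ofAdd (x, y)) = 1 ↔
      α * x ^ 2 + γ * x * y + β * y ^ 2 = 0 := by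
    rw [← hψ, ← hQ, Units.val_eq_one]
  have hb_one (x y x' y' : ZMod p) :
      metricForm q (Multiplicative.ofAdd (x, y)) (Multiplicative.ofAdd (x', y')) = 1 ↔
        (2 * α * x + γ * y) * x' + (γ * x + 2 * β * y) * y' = 0 := by
    rw [metricForm, mul_assoc, ← mul_inv, mul_inv_eq_one, ← Units.val_inj, Units.val_mul,
      ← ofAdd_add, Prod.mk_add_mk, hQ, hQ, hQ, ← map_add_eq_mul,
      ZMod.injective_stdAddChar.eq_iff, ← sub_eq_zero]
    ring_nf
  have hne (x y : ZMod p) : Multiplicative.ofAdd (x, y) ≠ 1 ↔ x ≠ 0 ∨ y ≠ 0 := by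
    rw [← ofAdd_zero, Ne, Multiplicative.ofAdd.injective.eq_iff, Prod.mk_eq_zero, not_and_or]
  have hrad (x y : ZMod p) (h₁ : 2 * α * x + γ * y = 0) (h₂ : γ * x + 2 * β * y = 0) :
      x = 0 ∧ y = 0 := by
    by_contra h
    refine (hne x y).mpr (by tauto) (hnd _ fun h ↦ ?_)
    exact (hb_one x y h.toAdd.1 h.toAdd.2).mpr (by rw [h₁, h₂]; ring)
  have hD : γ ^ 2 - 4 * α * β ≠ 0 := by
    intro hD
    obtain ⟨hγ, hα⟩ := hrad γ (-2 * α) (by ring) (by linear_combination hD)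
    have hα : α = 0 := by simpa [h2] using hα
    exact one_ne_zero (hrad 1 0 (by simp [hα]) (by simp [hγ])).1
  have hsum : ∑ g : Multiplicative (ZMod p × ZMod p), (q g : ℂ) =
      quadraticChar (ZMod p) (γ ^ 2 - 4 * α * β) * p := by
    rw [← Equiv.sum_comp Multiplicative.ofAdd, Fintype.sum_prod_type]
    simp only [hQ]
    rw [sum_addChar_binary_form hF (ZMod.isPrimitive_stdAddChar p) hD, ZMod.card]
  have hp0 : (p : ℂ) ≠ 0 := Nat.cast_ne_zero.mpr hp.ne_zero
  refine ⟨?_, ?_, ?_⟩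
  · rw [hsum]
    rcases quadraticChar_dichotomy hD with h | h <;> simp [h]
  · rw [hsum, mul_eq_right₀ hp0, Int.cast_eq_one, quadraticChar_one_iff_isSquare hD,
      isSquare_discrim_iff_exists_isotropic h2]
    constructor
    · rintro ⟨x, y, hxy, h⟩
      exact ⟨Multiplicative.ofAdd (x, y), (hne x y).mpr hxy, (hq_one x y).mpr h⟩
    · rintro ⟨g, hg, h⟩
      exact ⟨g.toAdd.1, g.toAdd.2, (hne _ _).mp hg, (hq_one _ _).mp h⟩
  · intro g hg hqg
    obtain ⟨⟨x, y⟩, rfl⟩ := Multiplicative.ofAdd.surjective g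
    have hxy := (hne x y).mp hg
    have hiso := (hq_one x y).mp hqg
    have hmem (u v : ZMod p) : Multiplicative.ofAdd (u, v) ∈
        Subgroup.zpowers (Multiplicative.ofAdd (x, y)) ↔ ∃ t, u = t * x ∧ v = t * y := by
      rw [Subgroup.mem_zpowers_iff]
      constructor
      · rintro ⟨k, hk⟩
        rw [← ofAdd_zsmul, Multiplicative.ofAdd.injective.eq_iff] at hk
        exact ⟨k, by simpa using (congrArg Prod.fst hk).symm,
          by simpa using (congrArg Prod.snd hk).symm⟩
      · rintro ⟨t, rfl, rfl⟩
        obtain ⟨k, rfl⟩ := ZMod.intCast_surjective t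
        exact ⟨k, by rw [← ofAdd_zsmul]; simp⟩
    refine ⟨?_, ?_, ?_⟩
    · intro h hh
      obtain ⟨⟨u, v⟩, rfl⟩ := Multiplicative.ofAdd.surjective h
      obtain ⟨t, rfl, rfl⟩ := (hmem u v).mp hh
      rw [hq_one]
      linear_combination t ^ 2 * hiso
    · ext h
      obtain ⟨⟨u, v⟩, rfl⟩ := Multiplicative.ofAdd.surjective h
      rw [SetLike.mem_coe, hmem, Set.mem_ofPred_eq]
      constructor
      · rintro ⟨t, rfl, rfl⟩ k hk
        obtain ⟨⟨u', v'⟩, rfl⟩ := Multiplicative.ofAdd.surjective k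
        obtain ⟨s, rfl, rfl⟩ := (hmem u' v').mp hk
        rw [hb_one]
        linear_combination 2 * t * s * hiso
      · intro h
        have hperp := (hb_one u v x y).mp (h _ (Subgroup.mem_zpowers _))
        have hdet : u * y - v * x = 0 := by
          by_contra hdet
          have hA : (2 * α * x + γ * y) * (u * y - v * x) = 0 := by
            linear_combination y * hperp - 2 * v * hiso
          have hB : (γ * x + 2 * β * y) * (u * y - v * x) = 0 := by
            linear_combination 2 * u * hiso - x * hperp
          have := hrad x y ((mul_eq_zero.mp hA).resolve_right hdet)
            ((mul_eq_zero.mp hB).resolve_right hdet)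
          tauto
        rcases hxy with hx | hy
        · refine ⟨u / x, by field_simp, ?_⟩
          field_simp
          linear_combination -hdet
        · refine ⟨v / y, ?_, by field_simp⟩
          field_simp
          linear_combination hdet
    · rw [Nat.card_zpowers]
      refine orderOf_eq_prime ?_ hg
      rw [← ofAdd_nsmul]
      simp
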